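/- Let m ≥ 1 and N ≥ 2 be integers and let p be a real number with 1 < p ≤ N − 1. Suppose a_1,…,a_m : [0,∞) → [0,∞) are continuous, f_1,…,f_m satisfy (C1)–(C2), and u_1,…,u_m : [0,∞) → [0,∞) are continuous functions satisfying u_i(r) = u_i(0) + ∫_0^r ( t^{1−N} ∫_0^t s^{N−1} a_i(s) f_i(u_1(s),…,u_m(s)) ds )^{1/(p−1)} dt for all r ≥ 0 and all i. If R > 0 is such that u_i(R) > 0 for every i = 1,…,m, then for every i and every r ≥ R, u_i(r) ≥ u_i(R) + f_i(u_1(R),…,u_m(R))^{1/(p−1)} · ∫_R^r ( t^{1−N} ∫_R^t s^{N−1} a_i(s) ds )^{1/(p−1)} dt. -/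

import Mathlib

open Real MeasureTheory Filter Set intervalIntegral

/-- `F(s) = ∫_0^s Σ_{i=1}^m f_i(t,…,t) dt`. -/
noncomputable def Fsum (m : ℕ) (f : Fin m → (Fin m → ℝ) → ℝ) (s : ℝ) : ℝ :=
  ∫ t in (0:ℝ)..s, ∑ i, f i (fun _ => t)

/-- Conditions (C1)–(C2): each `f j` maps `[0,∞)^m` to `[0,∞)`, is continuously
differentiable in each variable, vanishes at the origin, is positive when all
arguments are positive, and is nondecreasing in each variable. -/
def SatC12 (m : ℕ) (f : Fin m → (Fin m → ℝ) → ℝ) : Prop :=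
  (∀ j (i : Fin m) (s : Fin m → ℝ), (∀ l, 0 ≤ s l) →
    ContDiffOn ℝ 1 (fun t => f j (Function.update s i t)) (Set.Ici 0)) ∧
  (∀ j s, (∀ l, 0 ≤ s l) → 0 ≤ f j s) ∧
  (∀ j, f j (fun _ => 0) = 0) ∧
  (∀ j s, (∀ l, 0 < s l) → 0 < f j s) ∧
  (∀ j s t, (∀ l, 0 ≤ s l) → (∀ l, s l ≤ t l) → f j s ≤ f j t)

/-- Condition (C3): `∫_1^∞ F(s)^(-1/p) ds = ∞`. -/
def SatC3 (m : ℕ) (p : ℝ) (f : Fin m → (Fin m → ℝ) → ℝ) : Prop :=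
  Tendsto (fun r => ∫ s in (1:ℝ)..r, (Fsum m f s) ^ (-1/p)) atTop atTop

/-- A radial solution of the system with coefficients `b` and initial value `β`:
`w i r = β + ∫_0^r (t^(1-N) ∫_0^t s^(N-1) b i s · f i (w₁(s),…,w_m(s)) ds)^(1/(p-1)) dt`. -/
def IsRadialSolution (m N : ℕ) (p : ℝ) (b : Fin m → ℝ → ℝ)
    (f : Fin m → (Fin m → ℝ) → ℝ) (β : ℝ) (w : Fin m → ℝ → ℝ) : Prop :=
  (∀ i, ContinuousOn (w i) (Set.Ici 0)) ∧
  (∀ i r, 0 ≤ r → 0 ≤ w i r) ∧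
  (∀ i r, 0 ≤ r → w i r = β + ∫ t in (0:ℝ)..r,
      (t ^ (1 - (N:ℝ)) * ∫ s in (0:ℝ)..t,
        s ^ ((N:ℝ) - 1) * b i s * f i (fun j => w j s)) ^ (1/(p-1)))

/-- Upper semicontinuity step for monotone separately continuous functions. -/
lemma mono_sep_upper {m : ℕ} (g : (Fin m → ℝ) → ℝ)
    (hs : ∀ (i : Fin m) (s : Fin m → ℝ), Continuous (fun t => g (Function.update s i t)))
    (x : Fin m → ℝ) (b : ℝ) (hb : g x < b) (S : Finset (Fin m)) :
    ∃ y : Fin m → ℝ, (∀ l ∈ S, x l < y l) ∧ (∀ l, l ∉ S → y l = x l) ∧ g y < b := by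
  classical
  induction S using Finset.induction_on with
  | empty => exact ⟨x, by simp, by simp, hb⟩
  | insert i S hi ih =>
    obtain ⟨y, hy1, hy2, hy3⟩ := ih
    have hc := (hs i y).continuousAt (x := y i)
    have h0 : (fun t => g (Function.update y i t)) (y i) < b := by simpa using hy3
    have h1 : ∀ᶠ t in nhds (y i), g (Function.update y i t) < b := hc.eventually_lt_const h0
    obtain ⟨ε, hε, h2⟩ := Metric.eventually_nhds_iff.1 h1
    refine ⟨Function.update y i (y i + ε / 2), ?_, ?_, ?_⟩
    · intro l hl
      by_cases hli : l = i
      · subst hli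
        have := hy2 l hi
        simp; linarith
      · have : l ∈ S := by simpa [hli] using hl
        simpa [hli] using hy1 l this
    · intro l hl
      have h3 : l ≠ i ∧ l ∉ S := by simpa using hl
      simpa [h3.1] using hy2 l h3.2
    · apply h2
      rw [Real.dist_eq]
      rw [abs_of_pos] <;> linarith

lemma mono_sep_upper_ev {m : ℕ} (g : (Fin m → ℝ) → ℝ) (hg : Monotone g)
    (hs : ∀ (i : Fin m) (s : Fin m → ℝ), Continuous (fun t => g (Function.update s i t)))
    (x : Fin m → ℝ) (b : ℝ) (hb : g x < b) : ∀ᶠ z in nhds x, g z < b := by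
  obtain ⟨y, hy1, -, hy3⟩ := mono_sep_upper g hs x b hb Finset.univ
  have : ∀ᶠ z in nhds x, ∀ l, z l < y l := by
    rw [Filter.eventually_all]
    intro l
    exact (continuous_apply l).continuousAt.eventually_lt_const (hy1 l (Finset.mem_univ l))
  filter_upwards [this] with z hz
  exact (hg (fun l => (hz l).le)).trans_lt hy3

lemma mono_sep_continuous {m : ℕ} (g : (Fin m → ℝ) → ℝ) (hg : Monotone g)
    (hs : ∀ (i : Fin m) (s : Fin m → ℝ), Continuous (fun t => g (Function.update s i t))) :
    Continuous g := by
  rw [continuous_iff_continuousAt]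
  intro x
  apply tendsto_order.2
  refine ⟨fun b hb => ?_, fun b hb => mono_sep_upper_ev g hg hs x b hb⟩
  have := mono_sep_upper_ev (fun z => - g (-z)) (fun z w h => neg_le_neg (hg (neg_le_neg h)))
    (fun i s => by
      have h := ((hs i (-s)).comp continuous_neg).neg
      convert h using 3 with t
      show -g (-Function.update s i t) = -g (Function.update (-s) i (-t))
      congr 2
      ext l
      by_cases hl : l = i
      · subst hl; simp
      · simp [hl])
    (-x) (-b) (by simpa using hb)
  have h2 := (continuous_neg (G := Fin m → ℝ)).continuousAt (x := x) |>.eventually this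
  filter_upwards [h2] with z hz
  simpa using hz

lemma f_comp_cont {m : ℕ} (f : Fin m → (Fin m → ℝ) → ℝ) (hf : SatC12 m f)
    (u : Fin m → ℝ → ℝ) (huc : ∀ i, ContinuousOn (u i) (Set.Ici 0))
    (hunn : ∀ i r, 0 ≤ r → 0 ≤ u i r) (i : Fin m) :
    ContinuousOn (fun s => f i (fun j => u j s)) (Set.Ici 0) := by
  obtain ⟨h1, -, -, -, h5⟩ := hf
  have hg : Continuous (fun s : Fin m → ℝ => f i (fun l => max (s l) 0)) := by
    apply mono_sep_continuous
    · intro s t hst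
      exact h5 i _ _ (fun l => le_max_right _ _) (fun l => max_le_max_right _ (hst l))
    · intro k s
      have h := (h1 i k (fun l => max (s l) 0) (fun l => le_max_right _ _)).continuousOn
      have h' := h.comp_continuous (f := fun t : ℝ => max t 0) (by fun_prop)
        (fun t => Set.mem_Ici.2 (le_max_right _ _))
      convert h' using 2 with t
      show f i _ = f i (Function.update (fun l => max (s l) 0) k (max t 0))
      congr 1
      ext l
      by_cases hl : l = k
      · subst hl; simp
      · simp [hl]
  have hu : ContinuousOn (fun s => (fun j => u j s)) (Set.Ici (0:ℝ)) :=
    continuousOn_pi.2 huc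
  refine (hg.comp_continuousOn hu).congr ?_
  intro s hs
  simp only [Function.comp]
  congr 1
  ext l
  exact (max_eq_left (hunn l s hs)).symm

lemma prim_cont (φ : ℝ → ℝ) (c : ℝ) (hc : 0 ≤ c) (hφ : ContinuousOn φ (Set.Ici 0)) (r : ℝ)
    (hr : c ≤ r) : ContinuousOn (fun t => ∫ s in c..t, φ s) (Set.Icc c r) := by
  have h : ContinuousOn φ (Set.uIcc c r) := by
    rw [Set.uIcc_of_le hr]
    exact hφ.mono (fun x hx => le_trans hc hx.1)
  have := intervalIntegral.continuousOn_primitive_interval (μ := volume)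
    (h.integrableOn_compact isCompact_uIcc)
  rwa [Set.uIcc_of_le hr] at this

lemma outer_cont (N : ℕ) (q : ℝ) (hq : 0 < q) (φ : ℝ → ℝ) (c : ℝ) (hc : 0 ≤ c)
    (hφ : ContinuousOn φ (Set.Ici 0)) (r : ℝ) (hr : c ≤ r) :
    ContinuousOn (fun t : ℝ => (t ^ (1 - (N:ℝ)) * ∫ s in c..t, φ s) ^ q)
      (Set.Icc c r ∩ Set.Ioi 0) := by
  refine ContinuousOn.rpow_const ?_ (fun _ _ => Or.inr hq.le)
  refine ContinuousOn.mul ?_ ((prim_cont φ c hc hφ r hr).mono Set.inter_subset_left)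
  exact continuousOn_id.rpow_const (fun x hx => Or.inl (ne_of_gt hx.2))

lemma outer_int (N : ℕ) (hN : 2 ≤ N) (q : ℝ) (hq : 0 < q) (ψ : ℝ → ℝ)
    (hψ : ContinuousOn ψ (Set.Ici 0)) (hψ0 : ∀ s, 0 ≤ s → 0 ≤ ψ s) (r : ℝ) (hr : 0 ≤ r) :
    IntervalIntegrable (fun t : ℝ => (t ^ (1 - (N:ℝ)) *
      ∫ s in (0:ℝ)..t, s ^ ((N:ℝ) - 1) * ψ s) ^ q) volume 0 r := by
  have hN' : (2:ℝ) ≤ N := by exact_mod_cast hN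
  have hφ : ContinuousOn (fun s : ℝ => s ^ ((N:ℝ) - 1) * ψ s) (Set.Ici 0) :=
    (continuousOn_id.rpow_const (fun x hx => Or.inr (by linarith))).mul hψ
  obtain ⟨M, hM⟩ := (isCompact_Icc (a := (0:ℝ)) (b := r)).bddAbove_image
    (hψ.mono (fun x hx => hx.1))
  have hM' : ∀ s ∈ Set.Icc 0 r, ψ s ≤ M := fun s hs => hM ⟨s, hs, rfl⟩
  have hM0 : 0 ≤ M := (hψ0 0 le_rfl).trans (hM' 0 ⟨le_rfl, hr⟩)
  rw [intervalIntegrable_iff_integrableOn_Ioc_of_le hr]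
  have hcont := (outer_cont N q hq _ 0 le_rfl hφ r hr).mono
    (s := Set.Icc 0 r ∩ Set.Ioi 0) (t := Set.Ioc 0 r) (fun x hx => ⟨⟨hx.1.le, hx.2⟩, hx.1⟩)
  refine Integrable.mono' (g := fun _ => (r * M) ^ q) (integrable_const _)
    (hcont.aestronglyMeasurable measurableSet_Ioc) ?_
  refine (ae_restrict_iff' measurableSet_Ioc).2 (Eventually.of_forall fun t ht => ?_)
  have ht0 : 0 < t := ht.1
  have hI0 : 0 ≤ ∫ s in (0:ℝ)..t, s ^ ((N:ℝ) - 1) * ψ s :=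
    intervalIntegral.integral_nonneg ht0.le
      (fun s hs => mul_nonneg (Real.rpow_nonneg hs.1 _) (hψ0 s hs.1))
  have hb : ∫ s in (0:ℝ)..t, s ^ ((N:ℝ) - 1) * ψ s ≤ ∫ s in (0:ℝ)..t, t ^ ((N:ℝ) - 1) * M := by
    apply intervalIntegral.integral_mono_on ht0.le
    · apply ContinuousOn.intervalIntegrable
      rw [Set.uIcc_of_le ht0.le]
      exact hφ.mono (fun x hx => hx.1)
    · simp
    · intro s hs
      exact mul_le_mul (Real.rpow_le_rpow hs.1 hs.2 (by linarith))
        (hM' s ⟨hs.1, hs.2.trans ht.2⟩) (hψ0 s hs.1) (Real.rpow_nonneg ht0.le _)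
  have hp : 0 ≤ t ^ (1 - (N:ℝ)) := Real.rpow_nonneg ht0.le _
  rw [Real.norm_of_nonneg (Real.rpow_nonneg (mul_nonneg hp hI0) _)]
  refine Real.rpow_le_rpow (mul_nonneg hp hI0) ?_ hq.le
  have h1 : t ^ (1 - (N:ℝ)) * t ^ ((N:ℝ) - 1) = 1 := by
    rw [← Real.rpow_add ht0]; simp
  calc _ ≤ t ^ (1 - (N:ℝ)) * ∫ s in (0:ℝ)..t, t ^ ((N:ℝ) - 1) * M :=
        mul_le_mul_of_nonneg_left hb hp
    _ = (t ^ (1 - (N:ℝ)) * t ^ ((N:ℝ) - 1)) * (t * M) := by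
        rw [intervalIntegral.integral_const]; simp; ring
    _ = t * M := by rw [h1, one_mul]
    _ ≤ r * M := mul_le_mul_of_nonneg_right ht.2 hM0

/-- The lower bound used in the proof that solutions are large: if `u_i(R) > 0` for all
`i`, then for `r ≥ R`,
`u_i(r) ≥ u_i(R) + f_i(u(R))^(1/(p-1)) ∫_R^r (t^(1-N) ∫_R^t s^(N-1) a_i(s) ds)^(1/(p-1)) dt`. -/
theorem stmt11 (m N : ℕ) (p : ℝ) (hm : 1 ≤ m) (hN : 2 ≤ N)
    (hp1 : 1 < p) (hpN : p ≤ (N:ℝ) - 1)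
    (a : Fin m → ℝ → ℝ) (hac : ∀ j, ContinuousOn (a j) (Set.Ici 0))
    (hann : ∀ j r, 0 ≤ r → 0 ≤ a j r)
    (f : Fin m → (Fin m → ℝ) → ℝ) (hf12 : SatC12 m f)
    (u : Fin m → ℝ → ℝ) (huc : ∀ i, ContinuousOn (u i) (Set.Ici 0))
    (hunn : ∀ i r, 0 ≤ r → 0 ≤ u i r)
    (heq : ∀ i r, 0 ≤ r → u i r = u i 0 + ∫ t in (0:ℝ)..r,
      (t ^ (1 - (N:ℝ)) * ∫ s in (0:ℝ)..t,
        s ^ ((N:ℝ) - 1) * a i s * f i (fun j => u j s)) ^ (1/(p-1)))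
    (R : ℝ) (hR : 0 < R) (hpos : ∀ i, 0 < u i R) :
    ∀ (i : Fin m) (r : ℝ), R ≤ r →
      u i R + (f i (fun j => u j R)) ^ (1/(p-1)) *
          ∫ t in R..r, (t ^ (1 - (N:ℝ)) * ∫ s in R..t, s ^ ((N:ℝ) - 1) * a i s) ^ (1/(p-1))
        ≤ u i r := by
  have hN' : (2:ℝ) ≤ N := by exact_mod_cast hN
  have hq : 0 < 1 / (p - 1) := by apply one_div_pos.2; linarith
  set q := 1 / (p - 1) with hqdef
  have hf0 := hf12.2.1
  have hfm := hf12.2.2.2.2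
  have hψ : ∀ i, ContinuousOn (fun s => a i s * f i (fun j => u j s)) (Set.Ici 0) :=
    fun i => (hac i).mul (f_comp_cont f hf12 u huc hunn i)
  have hψ0 : ∀ i s, 0 ≤ s → 0 ≤ a i s * f i (fun j => u j s) :=
    fun i s hs => mul_nonneg (hann i s hs) (hf0 i _ (fun l => hunn l s hs))
  have hpw : ContinuousOn (fun s : ℝ => s ^ ((N:ℝ) - 1)) (Set.Ici 0) :=
    continuousOn_id.rpow_const (fun x hx => Or.inr (by linarith))
  have hφ : ∀ i, ContinuousOn (fun s => s ^ ((N:ℝ) - 1) * (a i s * f i (fun j => u j s)))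
      (Set.Ici 0) := fun i => hpw.mul (hψ i)
  have hφ0 : ∀ i s, 0 ≤ s → 0 ≤ s ^ ((N:ℝ) - 1) * (a i s * f i (fun j => u j s)) :=
    fun i s hs => mul_nonneg (Real.rpow_nonneg hs _) (hψ0 i s hs)
  have hint := fun i r hr => outer_int N hN q hq _ (hψ i) (hψ0 i) r hr
  simp only [mul_assoc] at heq
  have hdiff : ∀ i r, R ≤ r → u i r = u i R + ∫ t in R..r,
      (t ^ (1 - (N:ℝ)) * ∫ s in (0:ℝ)..t,
        s ^ ((N:ℝ) - 1) * (a i s * f i (fun j => u j s))) ^ q := by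
    intro i r hr
    have hr0 : 0 ≤ r := hR.le.trans hr
    rw [heq i r hr0, heq i R hR.le, add_assoc, intervalIntegral.integral_add_adjacent_intervals
      (hint i R hR.le) ((hint i R hR.le).symm.trans (hint i r hr0))]
  have hmono : ∀ i r, R ≤ r → u i R ≤ u i r := by
    intro i r hr
    rw [hdiff i r hr]
    have : 0 ≤ ∫ t in R..r, (t ^ (1 - (N:ℝ)) * ∫ s in (0:ℝ)..t,
        s ^ ((N:ℝ) - 1) * (a i s * f i (fun j => u j s))) ^ q := by
      apply intervalIntegral.integral_nonneg hr
      intro t ht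
      have ht0 : 0 ≤ t := hR.le.trans ht.1
      exact Real.rpow_nonneg (mul_nonneg (Real.rpow_nonneg ht0 _)
        (intervalIntegral.integral_nonneg ht0 (fun s hs => hφ0 i s hs.1))) _
    linarith
  intro i r hr
  have hr0 : 0 ≤ r := hR.le.trans hr
  set c := f i (fun j => u j R) with hcdef
  have hc0 : 0 ≤ c := hf0 i _ (fun l => hunn l R hR.le)
  have hpa : ContinuousOn (fun s => s ^ ((N:ℝ) - 1) * a i s) (Set.Ici 0) := hpw.mul (hac i)
  have hii : ∀ (g : ℝ → ℝ), ContinuousOn g (Set.Ici 0) → ∀ x y : ℝ, 0 ≤ x → 0 ≤ y →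
      IntervalIntegrable g volume x y := by
    intro g hg x y hx hy
    apply ContinuousOn.intervalIntegrable
    exact hg.mono (fun z hz => (le_min hx hy).trans hz.1)
  rw [hdiff i r hr, ← intervalIntegral.integral_const_mul]
  refine (add_le_add_iff_left _).2 ?_
  apply intervalIntegral.integral_mono_on hr
  · apply IntervalIntegrable.const_mul
    apply ContinuousOn.intervalIntegrable
    rw [Set.uIcc_of_le hr]
    exact (outer_cont N q hq _ R hR.le hpa r hr).mono
      (fun x hx => ⟨hx, hR.trans_le hx.1⟩)
  · exact (hint i R hR.le).symm.trans (hint i r hr0)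
  · intro t ht
    have ht0 : 0 ≤ t := hR.le.trans ht.1
    have hp0 : 0 ≤ t ^ (1 - (N:ℝ)) := Real.rpow_nonneg ht0 _
    have hJ : 0 ≤ ∫ s in R..t, s ^ ((N:ℝ) - 1) * a i s :=
      intervalIntegral.integral_nonneg ht.1 (fun s hs =>
        mul_nonneg (Real.rpow_nonneg (hR.le.trans hs.1) _) (hann i s (hR.le.trans hs.1)))
    rw [← Real.mul_rpow hc0 (mul_nonneg hp0 hJ)]
    refine Real.rpow_le_rpow (mul_nonneg hc0 (mul_nonneg hp0 hJ)) ?_ hq.le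
    rw [mul_left_comm]
    refine mul_le_mul_of_nonneg_left ?_ hp0
    rw [← intervalIntegral.integral_const_mul,
      ← intervalIntegral.integral_add_adjacent_intervals
        (hii _ (hφ i) 0 R le_rfl hR.le) (hii _ (hφ i) R t hR.le ht0)]
    have hA : 0 ≤ ∫ s in (0:ℝ)..R, s ^ ((N:ℝ) - 1) * (a i s * f i (fun j => u j s)) :=
      intervalIntegral.integral_nonneg hR.le (fun s hs => hφ0 i s hs.1)
    have hB : ∫ s in R..t, c * (s ^ ((N:ℝ) - 1) * a i s) ≤
        ∫ s in R..t, s ^ ((N:ℝ) - 1) * (a i s * f i (fun j => u j s)) := by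
      apply intervalIntegral.integral_mono_on ht.1
      · exact (hii _ hpa R t hR.le ht0).const_mul c
      · exact hii _ (hφ i) R t hR.le ht0
      · intro s hs
        have hs0 : 0 ≤ s := hR.le.trans hs.1
        have hcs : c ≤ f i (fun j => u j s) :=
          hfm i _ _ (fun l => hunn l R hR.le) (fun l => hmono l s hs.1)
        have := mul_le_mul_of_nonneg_left hcs
          (mul_nonneg (Real.rpow_nonneg hs0 ((N:ℝ) - 1)) (hann i s hs0))
        linarith
    linarith
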